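/- Let k be a natural number. There exists a constant C > 0 such that for every integer d > k + 2 and every real x, |(d/12)^((k+1)/2) · B_d^(k)(√(d/12)·x + d/2) − (1/√(2π)) · g^(k)(x)| ≤ C/d, where B_d^(k) denotes the k-th derivative of the cardinal B-spline of order d and g^(k) denotes the k-th derivative of the Gaussian g(x) = exp(−x²/2). -/

import Mathlib

open MeasureTheory Real Filter Finset

/-- The cardinal B-spline of order `d`: `B_1` is the indicator of `[0,1)`,
and `B_d = B_1 * B_{d-1}` (convolution) for `d ≥ 2`. -/
noncomputable def Bspline : ℕ → ℝ → ℝ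
  | 0, _ => 0
  | 1, x => if 0 ≤ x ∧ x < 1 then 1 else 0
  | (d + 2), x => ∫ y : ℝ, (if 0 ≤ x - y ∧ x - y < 1 then (1 : ℝ) else 0) * Bspline (d + 1) y

open scoped Convolution FourierTransform

lemma Bspline_conv (d : ℕ) : (fun x => (Bspline (d+2) x : ℂ)) =
    (fun x => (Bspline (d+1) x : ℂ)) ⋆[ContinuousLinearMap.mul ℂ ℂ] (fun x => (Bspline 1 x : ℂ)) := by
  ext x
  simp only [MeasureTheory.convolution, ContinuousLinearMap.mul_apply', Bspline]
  rw [← integral_complex_ofReal]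
  congr 1
  ext y
  push_cast
  ring

lemma Bspline_one_eq : (fun x => (Bspline 1 x : ℂ)) = Set.indicator (Set.Ico 0 1) (fun _ => (1:ℂ)) := by
  ext x
  simp only [Bspline, Set.indicator, Set.mem_Ico]
  split_ifs <;> simp

lemma Bspline_one_integrable : Integrable (fun x => (Bspline 1 x : ℂ)) := by
  rw [Bspline_one_eq]
  exact (integrable_indicator_iff measurableSet_Ico).2 (integrableOn_const (by simp))

lemma Bspline_integrable (d : ℕ) : Integrable (fun x => (Bspline (d+1) x : ℂ)) := by
  induction d with
  | zero => exact Bspline_one_integrable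
  | succ d ih =>
    rw [Bspline_conv]
    exact ih.integrable_convolution _ Bspline_one_integrable

lemma Bspline_real_integrable (d : ℕ) : Integrable (Bspline (d+1)) := by
  simpa using (Bspline_integrable d).re

lemma Bspline_continuous (d : ℕ) : Continuous (Bspline (d+2)) := by
  have h : Bspline (d+2) = fun x => (∫ y in (0:ℝ)..x, Bspline (d+1) y) - ∫ y in (0:ℝ)..(x-1), Bspline (d+1) y := by
    ext x
    have hi := Bspline_real_integrable d
    rw [intervalIntegral.integral_interval_sub_left hi.intervalIntegrable hi.intervalIntegrable,
      intervalIntegral.integral_of_le (by linarith), ← integral_indicator measurableSet_Ioc]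
    simp only [Bspline]
    congr 1
    ext y
    simp only [Set.indicator, Set.mem_Ioc]
    by_cases hc : x - 1 < y ∧ y ≤ x
    · rw [if_pos hc, if_pos ⟨by linarith, by linarith⟩, one_mul]
    · rw [if_neg hc, if_neg, zero_mul]
      rintro ⟨a, b⟩
      exact hc ⟨by linarith, by linarith⟩
  have hc : Continuous fun x : ℝ => ∫ y in (0:ℝ)..x, Bspline (d+1) y :=
    intervalIntegral.continuous_primitive (fun a b => (Bspline_real_integrable d).intervalIntegrable) 0
  rw [h]
  exact hc.sub (hc.comp (continuous_id.sub continuous_const))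

lemma fourier_Bspline_one (ξ : ℝ) : 𝓕 (fun x => (Bspline 1 x : ℂ)) ξ =
    Complex.exp (-(π * ξ) * Complex.I) * (sinc (π * ξ) : ℝ) := by
  rw [Bspline_one_eq, Real.fourier_eq']
  have h1 : (fun v : ℝ => Complex.exp (↑(-2 * π * inner ℝ v ξ) * Complex.I) •
      (Set.Ico 0 1).indicator (fun _ => (1:ℂ)) v) =
      (Set.Ico (0:ℝ) 1).indicator (fun v => Complex.exp ((-2 * π * ξ * Complex.I) * v)) := by
    ext v
    simp only [Set.indicator]
    split_ifs
    · simp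
      congr 1
      ring
    · simp
  rw [h1, integral_indicator measurableSet_Ico, integral_Ico_eq_integral_Ioc,
    ← intervalIntegral.integral_of_le zero_le_one]
  by_cases hξ : ξ = 0
  · simp [hξ]
  have hp : (π:ℂ) ≠ 0 := by exact_mod_cast Real.pi_ne_zero
  have hx : (ξ:ℂ) ≠ 0 := by exact_mod_cast hξ
  rw [integral_exp_mul_complex (by simp [hξ, Real.pi_ne_zero]),
    sinc_of_ne_zero (by simp [hξ, Real.pi_ne_zero])]
  push_cast
  rw [Complex.sin]
  have e1 : Complex.exp (-2 * π * ξ * Complex.I * 1) =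
     Complex.exp (-(π * ξ) * Complex.I) * Complex.exp (-(π * ξ) * Complex.I) := by
    rw [← Complex.exp_add]; congr 1; ring
  have e2 : Complex.exp (-(π * ξ) * Complex.I) * Complex.exp ((π * ξ) * Complex.I) = 1 := by
    rw [← Complex.exp_add, ← Complex.exp_zero]; congr 1; ring
  rw [e1]
  simp only [mul_zero, Complex.exp_zero]
  set E := Complex.exp (-(π * ξ) * Complex.I)
  set F := Complex.exp ((π * ξ) * Complex.I)
  have hI := Complex.I_sq
  field_simp
  linear_combination (-1) * e2 + (E * F - E^2) * hI

lemma fourier_Bspline (d : ℕ) (ξ : ℝ) : 𝓕 (fun x => (Bspline (d+1) x : ℂ)) ξ =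
    Complex.exp (-(π * ξ * (d+1)) * Complex.I) * ((sinc (π * ξ) ^ (d+1) : ℝ) : ℂ) := by
  induction d with
  | zero => simpa using fourier_Bspline_one ξ
  | succ d ih =>
    rw [Bspline_conv, Real.fourier_mul_convolution_eq (Bspline_integrable d) Bspline_one_integrable,
      ih, fourier_Bspline_one]
    have : Complex.exp (-(π * ξ * ((d+1:ℕ)+1)) * Complex.I) =
      Complex.exp (-(π * ξ * (d+1)) * Complex.I) * Complex.exp (-(π * ξ) * Complex.I) := by
      rw [← Complex.exp_add]; congr 1; push_cast; ring
    rw [this]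
    push_cast
    ring

lemma sinc_abs_le_inv (y : ℝ) (hy : y ≠ 0) : |sinc y| ≤ |y|⁻¹ := by
  rw [sinc_of_ne_zero hy, abs_div, div_eq_mul_inv]
  have := abs_sin_le_one y
  have h2 : 0 ≤ |y|⁻¹ := by positivity
  nlinarith

lemma sinc_pow_decay (n d : ℕ) (h : n + 2 ≤ d) (y : ℝ) :
    |y ^ n * sinc y ^ d| ≤ 2 * (1 + y^2)⁻¹ := by
  have h1 : 0 < 1 + y^2 := by positivity
  rw [abs_mul, abs_pow, abs_pow, ← div_eq_mul_inv, le_div_iff₀ h1]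
  have hs0 := abs_nonneg (sinc y)
  have hs1 := abs_sinc_le_one y
  rcases le_or_gt |y| 1 with hy | hy
  · have a1 : |y|^n ≤ 1 := pow_le_one₀ (abs_nonneg _) hy
    have a2 : |sinc y|^d ≤ 1 := pow_le_one₀ hs0 hs1
    have a3 : y^2 ≤ 1 := (sq_le_one_iff_abs_le_one y).2 hy
    have a4 : |y|^n * |sinc y|^d ≤ 1 := mul_le_one₀ a1 (by positivity) a2
    have a5 : 0 ≤ |y|^n * |sinc y|^d := by positivity
    nlinarith
  · have hy0 : 0 < |y| := by linarith
    have hne : y ≠ 0 := abs_pos.1 hy0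
    have b1 : |sinc y|^d ≤ |sinc y|^(n+2) := pow_le_pow_of_le_one hs0 hs1 h
    have b2 : |sinc y|^(n+2) ≤ (|y|⁻¹)^(n+2) := pow_le_pow_left₀ hs0 (sinc_abs_le_inv y hne) _
    have b3 : |y|^n * |sinc y|^d ≤ (|y|^2)⁻¹ := by
      calc |y|^n * |sinc y|^d ≤ |y|^n * (|y|⁻¹)^(n+2) := by gcongr; exact b1.trans b2
        _ = (|y|^2)⁻¹ := by
          rw [inv_pow, pow_add]
          field_simp
    have b4 : (1:ℝ) ≤ y^2 := by
      rw [← sq_abs]; nlinarith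
    calc |y|^n * |sinc y|^d * (1+y^2) ≤ (|y|^2)⁻¹ * (1+y^2) := by gcongr
      _ ≤ (|y|^2)⁻¹ * (2 * |y|^2) := by
        rw [sq_abs]; gcongr; linarith
      _ = 2 := by field_simp

lemma sinc_pow_integrable (n d : ℕ) (h : n + 2 ≤ d) (c : ℝ) (hc : c ≠ 0) :
    Integrable (fun x : ℝ => x^n * sinc (c * x)^d) := by
  have h1 : Integrable (fun x : ℝ => x^n * sinc x^d) := by
    refine Integrable.mono' (integrable_inv_one_add_sq.const_mul 2) ?_ ?_
    · exact ((continuous_pow n).mul (continuous_sinc.pow d)).aestronglyMeasurable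
    · exact ae_of_all _ (fun y => by rw [Real.norm_eq_abs]; exact sinc_pow_decay n d h y)
  have h2 := (h1.comp_mul_left' hc).const_mul ((c^n)⁻¹)
  convert h2 using 2 with x
  rw [mul_pow]
  field_simp

lemma deriv_ofReal' (f : ℝ → ℝ) (x : ℝ) :
    deriv (fun y => (f y : ℂ)) x = ((deriv f x : ℝ) : ℂ) := by
  by_cases h : DifferentiableAt ℝ f x
  · exact h.hasDerivAt.ofReal_comp.deriv
  · rw [deriv_zero_of_not_differentiableAt h, deriv_zero_of_not_differentiableAt, Complex.ofReal_zero]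
    intro h'
    apply h
    have := Complex.reCLM.differentiableAt.comp x h'
    exact this

lemma iteratedDeriv_ofReal' (k : ℕ) (f : ℝ → ℝ) :
    iteratedDeriv k (fun y => (f y : ℂ)) = fun x => ((iteratedDeriv k f x : ℝ) : ℂ) := by
  induction k with
  | zero => simp
  | succ k ih =>
    ext x
    rw [iteratedDeriv_succ, iteratedDeriv_succ, ih, deriv_ofReal']

lemma Bspline_repr (d : ℕ) (s : ℝ) (hs : 0 < s) (x : ℝ) :
    (s * (Bspline (d+2) (s * x + ((d+2:ℕ):ℝ)/2) : ℝ) : ℂ) =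
      𝓕 (fun η : ℝ => ((sinc (π / s * η) ^ (d+2) : ℝ) : ℂ)) x := by
  have hF : 𝓕 (fun x => (Bspline (d+2) x : ℂ)) = fun ξ : ℝ =>
    Complex.exp (-(π * ξ * ((d+1:ℕ)+1)) * Complex.I) * ((sinc (π * ξ) ^ (d+2) : ℝ) : ℂ) := by
    ext ξ
    exact fourier_Bspline (d+1) ξ
  have hint0 : Integrable (fun ξ : ℝ => ((sinc (π * ξ) ^ (d+2) : ℝ) : ℂ)) := by
    have := sinc_pow_integrable 0 (d+2) (by omega) π pi_ne_zero
    simp only [pow_zero, one_mul] at this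
    exact this.ofReal
  have hint : Integrable (𝓕 (fun x => (Bspline (d+2) x : ℂ))) := by
    rw [hF]
    refine hint0.bdd_mul (c := 1) ?_ ?_
    · exact Continuous.aestronglyMeasurable (by fun_prop)
    · refine ae_of_all _ fun ξ => ?_
      rw [show (-(π * ξ * ((d+1:ℕ)+1)) * Complex.I : ℂ) = ((-(π * ξ * ((d+1:ℕ)+1)) : ℝ) : ℂ) * Complex.I by push_cast; ring]
      rw [Complex.norm_exp_ofReal_mul_I]
  have hcont : Continuous (fun x => (Bspline (d+2) x : ℂ)) :=
    Complex.continuous_ofReal.comp (Bspline_continuous d)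
  have hinv := congrFun (hcont.fourierInv_fourier_eq (Bspline_integrable (d+1)) hint) (s * x + ((d+2:ℕ):ℝ)/2)
  rw [← hinv, hF, Real.fourierInv_eq', Real.fourier_eq']
  have hsub := Measure.integral_comp_mul_left (fun v : ℝ => Complex.exp (↑(-2 * π * inner ℝ v x) * Complex.I) •
      ((sinc (π / s * v) ^ (d+2) : ℝ) : ℂ)) (-s)
  have e : ∫ v : ℝ, Complex.exp (↑(-2 * π * inner ℝ v x) * Complex.I) •
      ((sinc (π / s * v) ^ (d+2) : ℝ) : ℂ) = s * ∫ v : ℝ, Complex.exp (↑(-2 * π * inner ℝ (-s * v) x) * Complex.I) •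
      ((sinc (π / s * (-s * v)) ^ (d+2) : ℝ) : ℂ) := by
    rw [hsub]
    have : |(-s)⁻¹| = s⁻¹ := by rw [abs_inv, abs_neg, abs_of_pos hs]
    rw [this, Complex.real_smul]
    have hsc : (s:ℂ) ≠ 0 := by exact_mod_cast hs.ne'
    rw [Complex.ofReal_inv, mul_inv_cancel_left₀ hsc]
  rw [e]
  congr 2
  ext v
  have a1 : π / s * (-s * v) = -(π * v) := by field_simp
  rw [a1, sinc_neg, smul_eq_mul, smul_eq_mul, ← mul_assoc, ← Complex.exp_add]
  congr 2
  simp only [RCLike.inner_apply, conj_trivial]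
  push_cast
  ring

lemma gauss_repr (x : ℝ) :
    (((1 / √(2 * π)) * Real.exp (-(x^2)/2) : ℝ) : ℂ) =
      𝓕 (fun η : ℝ => ((Real.exp (-(2 * π * η)^2/2) : ℝ) : ℂ)) x := by
  have h := congrFun (fourier_gaussian_pi (b := ((2*π:ℝ):ℂ)) (by simpa using pi_pos)) x
  have e : (fun η : ℝ => ((Real.exp (-(2 * π * η)^2/2) : ℝ) : ℂ)) =
     fun η : ℝ => Complex.exp (-π * ((2*π:ℝ):ℂ) * η^2) := by
    ext η
    push_cast
    congr 1
    ring
  rw [e, h]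
  have hp : (π:ℂ) ≠ 0 := by exact_mod_cast Real.pi_ne_zero
  rw [Real.sqrt_eq_rpow, show ((1:ℂ)/2) = ((1/2:ℝ):ℂ) by push_cast; rfl, ← Complex.ofReal_cpow (by positivity)]
  push_cast
  congr 2
  field_simp
lemma sin_ge_cubic (x : ℝ) (hx : 0 ≤ x) : x - x^3/6 ≤ sin x := by
  have hd : ∀ y : ℝ, HasDerivAt (fun y : ℝ => sin y - (y - y^3/6)) (cos y - (1 - y^2/2)) y := by
    intro y
    have h := (hasDerivAt_sin y).sub ((hasDerivAt_id y).sub ((hasDerivAt_pow 3 y).div_const 6))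
    refine h.congr_deriv ?_
    norm_num; ring
  have hm : MonotoneOn (fun y : ℝ => sin y - (y - y^3/6)) (Set.Ici 0) := by
    refine monotoneOn_of_hasDerivWithinAt_nonneg (convex_Ici 0)
      (fun y _ => (hd y).continuousAt.continuousWithinAt) (fun y _ => (hd y).hasDerivWithinAt) ?_
    intro y _
    linarith [one_sub_sq_div_two_le_cos (x := y)]
  have := hm (Set.mem_Ici.2 le_rfl) (Set.mem_Ici.2 hx) hx
  simp at this
  linarith

lemma cos_le_quartic (x : ℝ) (hx : 0 ≤ x) : cos x ≤ 1 - x^2/2 + x^4/24 := by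
  have hd : ∀ y : ℝ, HasDerivAt (fun y : ℝ => 1 - y^2/2 + y^4/24 - cos y) (sin y - (y - y^3/6)) y := by
    intro y
    have h := ((((hasDerivAt_pow 2 y).div_const 2).const_sub 1).add ((hasDerivAt_pow 4 y).div_const 24)).sub
      (hasDerivAt_cos y)
    refine h.congr_deriv ?_
    norm_num; ring
  have hm : MonotoneOn (fun y : ℝ => 1 - y^2/2 + y^4/24 - cos y) (Set.Ici 0) := by
    refine monotoneOn_of_hasDerivWithinAt_nonneg (convex_Ici 0)
      (fun y _ => (hd y).continuousAt.continuousWithinAt) (fun y _ => (hd y).hasDerivWithinAt) ?_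
    intro y hy
    rw [interior_Ici] at hy
    linarith [sin_ge_cubic y (Set.mem_Ioi.1 hy).le]
  have := hm (Set.mem_Ici.2 le_rfl) (Set.mem_Ici.2 hx) hx
  simp at this
  linarith

lemma sin_le_quintic (x : ℝ) (hx : 0 ≤ x) : sin x ≤ x - x^3/6 + x^5/120 := by
  have hd : ∀ y : ℝ, HasDerivAt (fun y : ℝ => y - y^3/6 + y^5/120 - sin y) (1 - y^2/2 + y^4/24 - cos y) y := by
    intro y
    have h := (((hasDerivAt_id y).sub ((hasDerivAt_pow 3 y).div_const 6)).add ((hasDerivAt_pow 5 y).div_const 120)).sub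
      (hasDerivAt_sin y)
    refine h.congr_deriv ?_
    norm_num; ring
  have hm : MonotoneOn (fun y : ℝ => y - y^3/6 + y^5/120 - sin y) (Set.Ici 0) := by
    refine monotoneOn_of_hasDerivWithinAt_nonneg (convex_Ici 0)
      (fun y _ => (hd y).continuousAt.continuousWithinAt) (fun y _ => (hd y).hasDerivWithinAt) ?_
    intro y hy
    rw [interior_Ici] at hy
    linarith [cos_le_quartic y (Set.mem_Ioi.1 hy).le]
  have := hm (Set.mem_Ici.2 le_rfl) (Set.mem_Ici.2 hx) hx
  simp at this
  linarith

lemma sinc_bounds (v : ℝ) : 1 - v^2/6 ≤ sinc v ∧ sinc v ≤ 1 - v^2/6 + v^4/120 := by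
  wlog hv : 0 ≤ v generalizing v
  · have := this (-v) (by linarith)
    rw [sinc_neg] at this
    convert this using 2 <;> ring
  rcases hv.eq_or_lt with rfl | hp
  · simp
  · rw [sinc_of_ne_zero hp.ne', le_div_iff₀ hp, div_le_iff₀ hp]
    constructor
    · linarith [sin_ge_cubic v hv]
    · linarith [sin_le_quintic v hv]

lemma exp_neg_upper (y : ℝ) (hy : 0 ≤ y) : Real.exp (-y) ≤ 1 - y + y^2/2 := by
  have hd : ∀ y : ℝ, HasDerivAt (fun y : ℝ => 1 - y + y^2/2 - Real.exp (-y)) (Real.exp (-y) - (1 - y)) y := by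
    intro y
    have h := ((((hasDerivAt_id y).const_sub 1)).add ((hasDerivAt_pow 2 y).div_const 2)).sub
      ((hasDerivAt_id y).neg.exp)
    refine h.congr_deriv ?_
    norm_num; ring
  have hm : MonotoneOn (fun y : ℝ => 1 - y + y^2/2 - Real.exp (-y)) (Set.Ici 0) := by
    refine monotoneOn_of_hasDerivWithinAt_nonneg (convex_Ici 0)
      (fun y _ => (hd y).continuousAt.continuousWithinAt) (fun y _ => (hd y).hasDerivWithinAt) ?_
    intro y hy
    linarith [add_one_le_exp (-y)]
  have := hm (Set.mem_Ici.2 le_rfl) (Set.mem_Ici.2 hy) hy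
  simp at this
  linarith

lemma pow_sub_pow_bound (a b m : ℝ) (ha : 0 ≤ a) (hb : 0 ≤ b) (ham : a ≤ m) (hbm : b ≤ m) (n : ℕ) :
    |a^(n+1) - b^(n+1)| ≤ (n+1) * |a - b| * m^n := by
  have hm : 0 ≤ m := ha.trans ham
  induction n with
  | zero => simp
  | succ n ih =>
    have e : a^(n+1+1) - b^(n+1+1) = a * (a^(n+1) - b^(n+1)) + (a - b) * b^(n+1) := by ring
    rw [e]
    calc _ ≤ |a * (a^(n+1) - b^(n+1))| + |(a-b) * b^(n+1)| := abs_add_le _ _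
      _ = a * |a^(n+1) - b^(n+1)| + |a-b| * b^(n+1) := by
        rw [abs_mul, abs_mul, abs_of_nonneg ha, abs_of_nonneg (pow_nonneg hb (n+1))]
      _ ≤ m * ((n+1) * |a - b| * m^n) + |a-b| * m^(n+1) := by gcongr
      _ = _ := by push_cast; ring

lemma near_bound (d : ℕ) (hd : 3 ≤ d) (u v : ℝ) (huv : d * v^2 = 3 * u^2) (hv : v^2 ≤ 4) :
    |sinc v ^ d - Real.exp (-u^2/2)| ≤ 9 / d * (|u|^4 * Real.exp (-(1/4) * u^2)) := by
  obtain ⟨n, rfl⟩ : ∃ n, d = n + 1 := ⟨d - 1, by omega⟩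
  have hn : (2:ℝ) ≤ n := by exact_mod_cast (by omega : 2 ≤ n)
  push_cast at huv
  obtain ⟨s1, s2⟩ := sinc_bounds v
  have v4 : v^4 = v^2 * v^2 := by ring
  have hv0 := sq_nonneg v
  have e1 := exp_neg_upper (v^2/6) (by positivity)
  have e2 := add_one_le_exp (-(v^2/6))
  have hexp : Real.exp (-u^2/2) = Real.exp (-(v^2/6)) ^ (n+1) := by
    rw [← Real.exp_nat_mul]; congr 1; push_cast; linarith
  have hm1 : sinc v ≤ Real.exp (-(2/15) * v^2) := by
    have := add_one_le_exp (-(2/15) * v^2)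
    nlinarith
  have hm2 : Real.exp (-(v^2/6)) ≤ Real.exp (-(2/15) * v^2) := Real.exp_le_exp.2 (by linarith)
  have hs0 : 0 ≤ sinc v := by linarith
  have hdiff : |sinc v - Real.exp (-(v^2/6))| ≤ v^4 := by
    rw [abs_le]; constructor <;> nlinarith
  have key := pow_sub_pow_bound _ _ _ hs0 (Real.exp_pos (-(v^2/6))).le hm1 hm2 n
  have hmn : Real.exp (-(2/15) * v^2) ^ n ≤ Real.exp (-(1/4) * u^2) := by
    rw [← Real.exp_nat_mul]
    apply Real.exp_le_exp.2
    nlinarith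
  rw [hexp]
  push_cast
  calc _ ≤ _ := key
    _ ≤ (n+1) * v^4 * Real.exp (-(1/4) * u^2) := by gcongr
    _ = _ := by
      have h4 : |u|^4 = u^4 := by rw [show 4 = 2*2 by rfl, pow_mul, pow_mul, sq_abs]
      rw [h4]
      have : v^2 = 3 * u^2 / (n+1) := by
        rw [eq_div_iff (by positivity)]; linarith
      rw [v4, this]
      field_simp
      ring

lemma far_bound (k d : ℕ) (hd : k + 2 < d) (u v : ℝ) (huv : d * v^2 = 3 * u^2) (hv : 4 < v^2) :
    |u|^k * |sinc v|^d ≤ ((d:ℝ)^(k+1) * (1/2)^(d-(k+2))) * (1+u^2)⁻¹ := by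
  have hd1 : (3:ℝ) ≤ d := by exact_mod_cast (by omega : 3 ≤ d)
  have hv2 : 2 < |v| := by
    by_contra! h
    rw [← sq_abs] at hv
    nlinarith [abs_nonneg v]
  have hvne : v ≠ 0 := abs_pos.1 (by linarith)
  have hsi := sinc_abs_le_inv v hvne
  have hs0 := abs_nonneg (sinc v)
  have hsh : |sinc v| ≤ 1/2 := hsi.trans (by rw [one_div]; gcongr)
  have hud : |u| ≤ d * |v| := by
    apply abs_le_of_sq_le_sq' _ (by positivity) |>.2
    rw [mul_pow, sq_abs, sq_abs]
    nlinarith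
  have hsplit : |sinc v|^d ≤ (1/2)^(d-(k+2)) * (|v|⁻¹)^(k+2) := by
    calc |sinc v|^d = |sinc v|^(d-(k+2)) * |sinc v|^(k+2) := by rw [← pow_add]; congr 1; omega
      _ ≤ _ := by gcongr
  have hvi : (|v|^2)⁻¹ ≤ d * (1+u^2)⁻¹ := by
    rw [sq_abs, ← div_eq_mul_inv, le_div_iff₀ (by positivity), inv_mul_le_iff₀ (by positivity)]
    nlinarith
  calc |u|^k * |sinc v|^d ≤ (d*|v|)^k * ((1/2)^(d-(k+2)) * (|v|⁻¹)^(k+2)) := by gcongr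
    _ = (d^k * (1/2)^(d-(k+2))) * (|v|^2)⁻¹ := by
      have : |v| ≠ 0 := by positivity
      rw [mul_pow, inv_pow, pow_add]
      field_simp
    _ ≤ (d^k * (1/2)^(d-(k+2))) * (d * (1+u^2)⁻¹) := by gcongr
    _ = _ := by ring

lemma const_bound (k : ℕ) : ∃ M : ℝ, 0 < M ∧ ∀ d : ℕ, k + 2 < d →
    (d:ℝ)^(k+1) * (1/2)^(d-(k+2)) ≤ M / d := by
  have ht := tendsto_pow_const_mul_const_pow_of_abs_lt_one (k+2) (r := 1/2) (by norm_num [abs_of_pos])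
  obtain ⟨M, hM⟩ := ht.bddAbove_range
  refine ⟨2^(k+2) * (|M|+1), by positivity, fun d hd => ?_⟩
  have hd0 : (0:ℝ) < d := by exact_mod_cast (by omega : 0 < d)
  rw [le_div_iff₀ hd0]
  have h1 : (d:ℝ)^(k+2) * (1/2)^d ≤ M := hM ⟨d, rfl⟩
  have h2 : ((1:ℝ)/2)^(d-(k+2)) = 2^(k+2) * (1/2)^d := by
    have : d = (d-(k+2)) + (k+2) := by omega
    conv_rhs => rw [this, pow_add (1/2 : ℝ)]
    rw [mul_left_comm, ← mul_pow]; norm_num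
  rw [h2]
  calc _ = 2^(k+2) * ((d:ℝ)^(k+2) * (1/2)^d) := by ring
    _ ≤ _ := by gcongr; linarith [le_abs_self M]

/-- dominating function -/
noncomputable def Hdom (k : ℕ) (u : ℝ) : ℝ :=
  |u|^(k+4) * Real.exp (-(1/4) * u^2) + |u|^(k+2) * Real.exp (-(1/4) * u^2) + (1+u^2)⁻¹

lemma Hdom_integrable (k : ℕ) : Integrable (Hdom k) := by
  have h : ∀ n : ℕ, Integrable (fun u : ℝ => |u|^n * Real.exp (-(1/4) * u^2)) := by
    intro n
    have := (integrable_rpow_mul_exp_neg_mul_sq (b := 1/4) (by norm_num) (s := n)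
      (by have : (0:ℝ) ≤ n := by positivity
          linarith)).norm
    refine this.congr (ae_of_all _ fun u => ?_)
    simp only [Real.rpow_natCast, norm_mul, norm_pow, Real.norm_eq_abs, Real.abs_exp]
  exact ((h _).add (h _)).add integrable_inv_one_add_sq

lemma pointwise_bound (k : ℕ) : ∃ M : ℝ, 0 < M ∧ ∀ d : ℕ, k + 2 < d → ∀ u v : ℝ,
    d * v^2 = 3 * u^2 → |u|^k * |sinc v ^ d - Real.exp (-u^2/2)| ≤ M / d * Hdom k u := by
  obtain ⟨M, hM0, hM⟩ := const_bound k
  refine ⟨M + 9, by positivity, fun d hd u v huv => ?_⟩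
  have hd0 : (0:ℝ) < d := by exact_mod_cast (by omega : 0 < d)
  have p1 : 0 ≤ |u|^(k+4) * Real.exp (-(1/4) * u^2) := by positivity
  have p2 : 0 ≤ |u|^(k+2) * Real.exp (-(1/4) * u^2) := by positivity
  have p3 : 0 ≤ (1+u^2)⁻¹ := by positivity
  rw [div_mul_eq_mul_div, le_div_iff₀ hd0, Hdom]
  rcases le_or_gt (v^2) 4 with hv | hv
  · have := near_bound d (by omega) u v huv hv
    have h2 : |u|^k * |sinc v ^ d - Real.exp (-u^2/2)| * d ≤ 9 * (|u|^(k+4) * Real.exp (-(1/4) * u^2)) := by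
      calc _ ≤ |u|^k * (9 / d * (|u|^4 * Real.exp (-(1/4) * u^2))) * d := by gcongr
        _ = _ := by rw [pow_add]; field_simp
    nlinarith
  · have h1 := far_bound k d hd u v huv hv
    have h1' : |u|^k * |sinc v|^d * d ≤ M * (1+u^2)⁻¹ := by
      calc _ ≤ (M / d * (1+u^2)⁻¹) * d := by
            refine mul_le_mul_of_nonneg_right (h1.trans ?_) hd0.le
            exact mul_le_mul_of_nonneg_right (hM d hd) p3
        _ = _ := by field_simp
    have h2 : |u|^k * Real.exp (-u^2/2) * d ≤ 9 * (|u|^(k+2) * Real.exp (-(1/4) * u^2)) := by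
      have : (d:ℝ) ≤ 3 * |u|^2 := by rw [sq_abs]; nlinarith
      have he : Real.exp (-u^2/2) ≤ Real.exp (-(1/4) * u^2) := Real.exp_le_exp.2 (by nlinarith [sq_nonneg u])
      calc _ ≤ |u|^k * Real.exp (-(1/4) * u^2) * (3 * |u|^2) := by gcongr
        _ = 3 * (|u|^(k+2) * Real.exp (-(1/4) * u^2)) := by rw [pow_add]; ring
        _ ≤ _ := by linarith
    have h3 : |sinc v ^ d - Real.exp (-u^2/2)| ≤ |sinc v|^d + Real.exp (-u^2/2) := by
      have := abs_sub (sinc v ^ d) (Real.exp (-u^2/2))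
      rwa [abs_pow, Real.abs_exp] at this
    calc _ ≤ |u|^k * (|sinc v|^d + Real.exp (-u^2/2)) * d := by gcongr
      _ = |u|^k * |sinc v|^d * d + |u|^k * Real.exp (-u^2/2) * d := by ring
      _ ≤ _ := by nlinarith

lemma iteratedDeriv_comp_affine (k : ℕ) (f : ℝ → ℝ) (s c : ℝ) :
    iteratedDeriv k (fun x => f (s * x + c)) = fun x => s^k * iteratedDeriv k f (s * x + c) := by
  induction k with
  | zero => simp
  | succ k ih =>
    ext x
    rw [iteratedDeriv_succ, ih, deriv_const_mul_field]
    have h := deriv_comp_mul_left s (fun y => iteratedDeriv k f (y + c)) x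
    rw [h, deriv_comp_add_const, ← iteratedDeriv_succ, smul_eq_mul]
    ring

lemma gauss_integrable (n : ℕ) :
    Integrable (fun η : ℝ => η^n • ((Real.exp (-(2 * π * η)^2/2) : ℝ) : ℂ)) := by
  have := (integrable_rpow_mul_exp_neg_mul_sq (b := 2 * π^2) (by positivity) (s := n)
      (by have : (0:ℝ) ≤ n := by positivity
          linarith)).ofReal (𝕜 := ℂ)
  refine this.congr (ae_of_all _ fun u => ?_)
  have e : -(2 * π * u)^2/2 = -(2 * π^2) * u^2 := by ring
  simp only [Real.rpow_natCast, Complex.real_smul, e]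
  rw [← Complex.ofReal_mul]
  rfl

lemma fourier_sub_bound (f g : ℝ → ℂ) (hf : Integrable f) (hg : Integrable g) (h : ℝ → ℝ)
    (hh : Integrable h) (hb : ∀ η, ‖f η - g η‖ ≤ h η) (x : ℝ) : ‖𝓕 f x - 𝓕 g x‖ ≤ ∫ η, h η := by
  have hf' := (Real.fourierIntegral_convergent_iff x).2 hf
  have hg' := (Real.fourierIntegral_convergent_iff x).2 hg
  rw [Real.fourier_eq, Real.fourier_eq, ← integral_sub hf' hg']
  refine norm_integral_le_of_norm_le hh (ae_of_all _ fun η => ?_)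
  rw [← smul_sub, Circle.norm_smul]
  exact hb η

theorem bspline_deriv_gaussian_rate (k : ℕ) :
    ∃ C : ℝ, 0 < C ∧ ∀ d : ℕ, k + 2 < d → ∀ x : ℝ,
      |((d : ℝ) / 12) ^ (((k : ℝ) + 1) / 2) *
          iteratedDeriv k (Bspline d) (Real.sqrt ((d : ℝ) / 12) * x + (d : ℝ) / 2) -
        (1 / Real.sqrt (2 * π)) * iteratedDeriv k (fun t : ℝ => Real.exp (-(t ^ 2) / 2)) x| ≤
        C / d := by
  obtain ⟨M, hM0, hM⟩ := pointwise_bound k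
  have hHi : Integrable (fun η : ℝ => Hdom k (2 * π * η)) :=
    (Hdom_integrable k).comp_mul_left' (by positivity)
  have hK : 0 ≤ ∫ η : ℝ, Hdom k (2 * π * η) := by
    refine integral_nonneg fun η => ?_
    simp only [Pi.zero_apply, Hdom]
    positivity
  refine ⟨M * ((∫ η : ℝ, Hdom k (2 * π * η)) + 1), by positivity, fun d hd x => ?_⟩
  have hd0 : (0:ℝ) < d := by exact_mod_cast (by omega : 0 < d)
  set s := √((d:ℝ)/12) with hs
  have hs0 : 0 < s := Real.sqrt_pos.2 (by positivity)
  have hs2 : s^2 = d/12 := Real.sq_sqrt (by positivity)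
  have hpow : ((d : ℝ) / 12) ^ (((k : ℝ) + 1) / 2) = s^(k+1) := by
    rw [hs, Real.sqrt_eq_rpow, ← Real.rpow_natCast, ← Real.rpow_mul (by positivity)]
    congr 1
    push_cast
    ring
  -- the two transforms
  set P : ℝ → ℂ := fun η => ((sinc (π / s * η) ^ d : ℝ) : ℂ) with hP
  set G : ℝ → ℂ := fun η => ((Real.exp (-(2 * π * η)^2/2) : ℝ) : ℂ) with hG
  have hPi : ∀ n : ℕ, n ≤ k → Integrable (fun η : ℝ => η^n • P η) := by
    intro n hn
    have := (sinc_pow_integrable n d (by omega) (π / s) (by positivity)).ofReal (𝕜 := ℂ)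
    refine this.congr (ae_of_all _ fun u => ?_)
    simp [hP, Complex.real_smul]
  have hA : (fun y : ℝ => ((s * Bspline d (s * y + (d:ℝ)/2) : ℝ) : ℂ)) = 𝓕 P := by
    ext y
    obtain ⟨m, rfl⟩ : ∃ m, d = m + 2 := ⟨d - 2, by omega⟩
    rw [Complex.ofReal_mul]
    exact Bspline_repr m s hs0 y
  have hB : (fun y : ℝ => (((1 / √(2 * π)) * Real.exp (-(y^2)/2) : ℝ) : ℂ)) = 𝓕 G := by
    ext y
    exact gauss_repr y
  have dA := congrFun (congrArg (iteratedDeriv k) hA) x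
  have dB := congrFun (congrArg (iteratedDeriv k) hB) x
  rw [iteratedDeriv_ofReal', Real.iteratedDeriv_fourier (N := k) (fun n hn => hPi n (by exact_mod_cast hn)) le_rfl] at dA
  beta_reduce at dA
  rw [iteratedDeriv_const_mul_field, iteratedDeriv_comp_affine] at dA
  rw [iteratedDeriv_ofReal', Real.iteratedDeriv_fourier (N := k) (fun n hn => gauss_integrable n) le_rfl] at dB
  beta_reduce at dB
  rw [iteratedDeriv_const_mul_field] at dB
  have conv : ∀ F : ℝ → ℂ, Integrable (fun η : ℝ => η^k • F η) →
      Integrable (fun η : ℝ => (-2 * π * Complex.I * η)^k • F η) := by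
    intro F hF
    refine (hF.const_mul ((-2 * π * Complex.I)^k)).congr (ae_of_all _ fun u => ?_)
    simp only [Complex.real_smul, smul_eq_mul, mul_pow]
    push_cast
    ring
  have hfin := fourier_sub_bound _ _ (conv P (hPi k le_rfl)) (conv G (gauss_integrable k))
    (fun η => M / d * Hdom k (2 * π * η)) (hHi.const_mul _) ?_ x
  · rw [← dA, ← dB, ← Complex.ofReal_sub, Complex.norm_real, Real.norm_eq_abs, integral_const_mul] at hfin
    rw [hpow]
    calc _ = _ := by
          congr 1
          ring
      _ ≤ _ := hfin
      _ ≤ _ := by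
        rw [div_mul_eq_mul_div]
        gcongr
        linarith
  · intro η
    rw [← smul_sub, norm_smul, norm_pow, hP, hG]
    simp only
    rw [← Complex.ofReal_sub, Complex.norm_real, Real.norm_eq_abs]
    have e : ‖(-2 * π * Complex.I * η : ℂ)‖ = |2 * π * η| := by
      simp [abs_mul, abs_of_pos pi_pos]
    rw [e]
    refine hM d hd (2 * π * η) (π / s * η) ?_
    rw [mul_pow, div_pow, hs2]
    field_simp
    ring
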